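/- arXiv:2508.12417 — 4 statements merged into one kernel-verified Lean document; each statement's English description precedes it below -/
import Mathlib

section
/- In a ring of butterflies R_m with m ≥ 3 links, every hinge {aᵢ,bᵢ} is an implied nonedge, i.e., rank₃(R_m + {aᵢ,bᵢ}) = rank₃(R_m). -/
noncomputable section

open scoped RealInnerProductSpace

namespace Rigidity

variable {V : Type*}

/-- The row of the rigidity matrix of the framework `p` corresponding to the
ordered pair `(x, y)`: it has `p x - p y` in the three columns of `x`,
`p y - p x` in the three columns of `y`, and `0` elsewhere. -/
def rigidityRow [DecidableEq V] (p : V → Fin 3 → ℝ) (x y : V) : V × Fin 3 → ℝ :=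
  fun vi =>
    (if vi.1 = x then p x vi.2 - p y vi.2 else 0) +
    (if vi.1 = y then p y vi.2 - p x vi.2 else 0)

/-- The rank of the rigidity matrix of the framework `(G, p)`, i.e. the dimension of
the span of its rows (one row for each edge of `G`). -/
def rigidityRank [DecidableEq V] (G : SimpleGraph V) (p : V → Fin 3 → ℝ) : ℕ :=
  Module.finrank ℝ
    (Submodule.span ℝ {w : V × Fin 3 → ℝ | ∃ x y, G.Adj x y ∧ w = rigidityRow p x y})

/-- The generic 3-dimensional rank `rank₃ G`: the maximum, over all frameworks `p`,
of the rank of the rigidity matrix `R(G, p)`. -/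
def genRank [DecidableEq V] (G : SimpleGraph V) : ℕ :=
  sSup {n : ℕ | ∃ p : V → Fin 3 → ℝ, n = rigidityRank G p}

/-- `G` is independent in the generic 3-dimensional rigidity matroid. -/
def IsIndependent [DecidableEq V] (G : SimpleGraph V) : Prop :=
  genRank G = G.edgeSet.ncard

/-- `G` is (generically) rigid in dimension 3: `rank₃ G = 3|V| - 6`. -/
def IsRigid [DecidableEq V] (G : SimpleGraph V) : Prop :=
  genRank G = 3 * Nat.card V - 6

/-- `G` is nucleation-free: it has no rigid subgraph on at least 5 vertices. -/
def NucleationFree [DecidableEq V] (G : SimpleGraph V) : Prop :=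
  ∀ H : G.Subgraph, 5 ≤ H.verts.ncard → ¬ IsRigid H.coe

/-- The graph `G + {x,y}` obtained from `G` by adding the edge `{x, y}`. -/
def addEdge (G : SimpleGraph V) (x y : V) : SimpleGraph V :=
  G ⊔ SimpleGraph.fromEdgeSet {s(x, y)}

/-- `{x, y}` is an implied nonedge of `G`: it is a nonedge and adding it
does not change the generic 3-dimensional rank. -/
def ImpliedNonedge [DecidableEq V] (G : SimpleGraph V) (x y : V) : Prop :=
  x ≠ y ∧ ¬ G.Adj x y ∧ genRank (addEdge G x y) = genRank G

/-- `G` is a circuit of the generic 3-dimensional rigidity matroid: it is dependent and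
deleting any one edge yields an independent graph. -/
def IsCircuit [DecidableEq V] (G : SimpleGraph V) : Prop :=
  ¬ IsIndependent G ∧ ∀ e ∈ G.edgeSet, IsIndependent (G.deleteEdges {e})

/-- The vertex set `W` is contained in some `K₄` subgraph of `G`. -/
def ContainedInK4 (G : SimpleGraph V) (W : Set V) : Prop :=
  ∃ s : Set V, W ⊆ s ∧ s.ncard = 4 ∧ G.IsClique s

/-- The canonical ring of `m` butterflies: vertices `(i, 0) = aᵢ`, `(i, 1) = bᵢ` and
`(i, 2) = eᵢ`; link `i` is the complete graph on `aᵢ, bᵢ, eᵢ, aᵢ₊₁, bᵢ₊₁` minus the two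
hinge pairs `{aᵢ, bᵢ}` and `{aᵢ₊₁, bᵢ₊₁}` (a butterfly). -/
def butterflyRing (m : ℕ) : SimpleGraph (ZMod m × Fin 3) :=
  SimpleGraph.fromRel fun x y =>
    (x.1 = y.1 ∧ x ≠ y ∧ (x.2 = 2 ∨ y.2 = 2)) ∨ (y.1 = x.1 + 1 ∧ y.2 ≠ 2)

/-- `G` is a ring of `m` butterflies with hinges `{a i, b i}`. -/
def IsRingOfButterflies (m : ℕ) (G : SimpleGraph V) (a b : ZMod m → V) : Prop :=
  ∃ φ : G ≃g butterflyRing m, (∀ i, φ (a i) = (i, 0)) ∧ (∀ i, φ (b i) = (i, 1))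

/-- `G` is a ring of `m` butterflies with vertex set `S`, vertex labelling `f`
(all vertices of `V` outside `S` being isolated in `G`). -/
def IsRingOfButterfliesOn (m : ℕ) (G : SimpleGraph V) (S : Set V)
    (f : ZMod m × Fin 3 → V) : Prop :=
  Function.Injective f ∧ Set.range f = S ∧ G.support ⊆ S ∧
    ∀ x y, G.Adj (f x) (f y) ↔ (butterflyRing m).Adj x y

/-- `R` is a ring with links `L i` (subgraphs of `R`) and hinges `{a i, b i}`:
the links cover `R`, the `2m` hinge vertices are pairwise distinct, link `i` contains the
hinge vertices `a i, b i, a (i+1), b (i+1)`, and two distinct links share only hinge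
vertices common to both of them. -/
def IsRingDecomp (m : ℕ) (R : SimpleGraph V) (L : ZMod m → R.Subgraph)
    (a b : ZMod m → V) : Prop :=
  (⨆ i, (L i).spanningCoe) = R ∧
  Function.Injective (fun x : ZMod m × Bool => if x.2 then a x.1 else b x.1) ∧
  (∀ i, a i ∈ (L i).verts ∧ b i ∈ (L i).verts ∧
    a (i + 1) ∈ (L i).verts ∧ b (i + 1) ∈ (L i).verts) ∧
  (∀ i j, i ≠ j →
    (L i).verts ∩ (L j).verts ⊆
      ({a i, b i, a (i + 1), b (i + 1)} : Set V) ∩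
        ({a j, b j, a (j + 1), b (j + 1)} : Set V))

/-- The shared set `S(𝒳)` of a cover: all pairs `{x, y}` of distinct vertices such that
`{x, y} = X ∩ Y` for two distinct clusters `X, Y` of `𝒳`. -/
def sharedSet (𝒳 : Finset (Set V)) : Set (Sym2 V) :=
  {e | ∃ x y : V, x ≠ y ∧ e = s(x, y) ∧ ∃ X ∈ 𝒳, ∃ Y ∈ 𝒳, X ≠ Y ∧ X ∩ Y = {x, y}}

/-- `d(𝒳, e)`: the number of clusters of `𝒳` containing both endpoints of `e`. -/
def coverDeg (𝒳 : Finset (Set V)) (e : Sym2 V) : ℕ :=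
  {X : Set V | X ∈ 𝒳 ∧ ∀ v ∈ e, v ∈ X}.ncard

/-- `𝒳` is a 2-thin cover of `G`. -/
def IsTwoThinCover (G : SimpleGraph V) (𝒳 : Finset (Set V)) : Prop :=
  (∀ X ∈ 𝒳, 2 ≤ X.ncard) ∧
  (∀ X ∈ 𝒳, ∀ Y ∈ 𝒳, X ≠ Y → (X ∩ Y).ncard ≤ 2 ∧ ¬ X ⊂ Y) ∧
  (∀ x y : V, G.Adj x y → ∃ X ∈ 𝒳, x ∈ X ∧ y ∈ X)

/-- `Gs` is a nonedge-split of `G` at the nonedge `{a, b}` with new vertices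
`a₁, a₂, b₁, b₂`: the neighborhoods of `a₁, a₂` partition the neighborhood of `a`, the
neighborhoods of `b₁, b₂` partition the neighborhood of `b`, and `a`, `b` are deleted
(i.e. become isolated). -/
def IsNonedgeSplit (G Gs : SimpleGraph V) (a b a₁ a₂ b₁ b₂ : V) : Prop :=
  ¬ G.Adj a b ∧
  ([a, b, a₁, a₂, b₁, b₂] : List V).Pairwise (· ≠ ·) ∧
  a₁ ∉ G.support ∧ a₂ ∉ G.support ∧ b₁ ∉ G.support ∧ b₂ ∉ G.support ∧
  ∃ A ⊆ G.neighborSet a, ∃ B ⊆ G.neighborSet b,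
    Gs = (G.deleteEdges {e | a ∈ e ∨ b ∈ e}) ⊔
      SimpleGraph.fromEdgeSet
        (((fun w => s(a₁, w)) '' A) ∪ ((fun w => s(a₂, w)) '' (G.neighborSet a \ A)) ∪
         ((fun w => s(b₁, w)) '' B) ∪ ((fun w => s(b₂, w)) '' (G.neighborSet b \ B)))

/-- The double-butterfly on the eight vertices `a₁, a₂, b₁, b₂, u, v, c, c'`. -/
def doubleButterfly (a₁ a₂ b₁ b₂ u v c c' : V) : SimpleGraph V :=
  SimpleGraph.fromEdgeSet
    {s(a₁, u), s(a₁, v), s(a₂, u), s(a₂, v), s(b₁, u), s(b₁, v), s(b₂, u), s(b₂, v),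
     s(c, a₁), s(c, b₁), s(c, u), s(c, v), s(c', a₂), s(c', b₂), s(c', u), s(c', v)}

/-- `G'` is obtained from `G` by a double-butterfly split-and-glue at the nonedge
`{a, b}`: a nonedge-split of `G` at `{a, b}` with new vertices `a₁, a₂, b₁, b₂`, followed by
gluing a double-butterfly (with fresh vertices `u, v, c, c'`) along `a₁, a₂, b₁, b₂`. -/
def IsDoubleButterflySG (G G' : SimpleGraph V)
    (a b a₁ a₂ b₁ b₂ u v c c' : V) : Prop :=
  ∃ Gs : SimpleGraph V, IsNonedgeSplit G Gs a b a₁ a₂ b₁ b₂ ∧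
    ([a, b, a₁, a₂, b₁, b₂, u, v, c, c'] : List V).Pairwise (· ≠ ·) ∧
    u ∉ G.support ∧ v ∉ G.support ∧ c ∉ G.support ∧ c' ∉ G.support ∧
    G' = Gs ⊔ doubleButterfly a₁ a₂ b₁ b₂ u v c c'

/-- `s` is an equilibrium self-stress of the framework `(G, p)`. -/
def IsSelfStress [Fintype V] (G : SimpleGraph V) [DecidableRel G.Adj]
    (p : V → EuclideanSpace ℝ (Fin 3)) (s : Sym2 V → ℝ) : Prop :=
  ∀ x : V, (∑ y : V, if G.Adj x y then s s(x, y) • (p x - p y) else 0) = 0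

/-- `K(U)`: the edge set of the complete graph on the vertex set `U`. -/
def completeOn (U : Set V) : Set (Sym2 V) :=
  {e | ¬ e.IsDiag ∧ ∀ v ∈ e, v ∈ U}

/-- `V(E)`: the set of endpoints of the pairs in `E`. -/
def vertexSet (E : Set (Sym2 V)) : Set V := {v | ∃ e ∈ E, v ∈ e}

/-- `M` is an abstract `d`-rigidity matroid (axioms C1 and C2). -/
def IsAbstractRigidityMatroid (d : ℕ) (M : Matroid (Sym2 V)) : Prop :=
  (∀ E₁ E₂ : Set (Sym2 V), E₁ ⊆ M.E → E₂ ⊆ M.E →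
     (vertexSet E₁ ∩ vertexSet E₂).ncard ≤ d - 1 →
     M.closure (E₁ ∪ E₂) ⊆ completeOn (vertexSet E₁) ∪ completeOn (vertexSet E₂)) ∧
  (∀ E₁ E₂ : Set (Sym2 V), E₁ ⊆ M.E → E₂ ⊆ M.E →
     d ≤ (vertexSet E₁ ∩ vertexSet E₂).ncard →
     M.closure E₁ = completeOn (vertexSet E₁) →
     M.closure E₂ = completeOn (vertexSet E₂) →
     M.closure (E₁ ∪ E₂) = completeOn (vertexSet E₁ ∪ vertexSet E₂))

/-- Six times the signed volume of the tetrahedron with vertices `x, y, z, w`. -/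
def tetraVolume (x y z w : Fin 3 → ℝ) : ℝ :=
  Matrix.det (Matrix.of ![y - x, z - x, w - x])

theorem tetraVolume_eq (x y z w : Fin 3 → ℝ) :
    tetraVolume x y z w =
      (y 0 - x 0) * (z 1 - x 1) * (w 2 - x 2) - (y 0 - x 0) * (z 2 - x 2) * (w 1 - x 1) -
      (y 1 - x 1) * (z 0 - x 0) * (w 2 - x 2) + (y 1 - x 1) * (z 2 - x 2) * (w 0 - x 0) +
      (y 2 - x 2) * (z 0 - x 0) * (w 1 - x 1) - (y 2 - x 2) * (z 1 - x 1) * (w 0 - x 0) := by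
  simp [tetraVolume, Matrix.det_fin_three]

/-- The coefficients of the canonical affine dependence of five points in `ℝ³` sum to zero. -/
theorem tetraVolume_sum_eq_zero (a b c d e : Fin 3 → ℝ) :
    tetraVolume b c d e - tetraVolume a c d e + tetraVolume a b d e - tetraVolume a b c e +
      tetraVolume a b c d = 0 := by
  simp only [tetraVolume_eq]
  ring

/-- The canonical affine dependence of five points in `ℝ³`. -/
theorem tetraVolume_weighted_sum_eq_zero (a b c d e : Fin 3 → ℝ) (k : Fin 3) :
    tetraVolume b c d e * a k - tetraVolume a c d e * b k + tetraVolume a b d e * c k -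
      tetraVolume a b c e * d k + tetraVolume a b c d * e k = 0 := by
  simp only [tetraVolume_eq]
  fin_cases k <;> dsimp <;> ring

/-- The product of the volume coefficients of `x` and `y` in the canonical affine dependence of
`x, y, z, u, v`: up to sign, the coefficient of the edge `{x, y}` in the stress of `K₅`. -/
def hingeCoeff (x y z u v : Fin 3 → ℝ) : ℝ :=
  tetraVolume y z u v * tetraVolume x z u v

/-- The moment curve in `ℝ³`. -/
def momentCurve (t : ℝ) : Fin 3 → ℝ := ![t, t ^ 2, t ^ 3]

theorem tetraVolume_momentCurve (s t u v : ℝ) :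
    tetraVolume (momentCurve s) (momentCurve t) (momentCurve u) (momentCurve v) =
      (t - s) * (u - s) * (v - s) * (u - t) * (v - t) * (v - u) := by
  have h₀ (r : ℝ) : momentCurve r 0 = r := rfl
  have h₁ (r : ℝ) : momentCurve r 1 = r ^ 2 := rfl
  have h₂ (r : ℝ) : momentCurve r 2 = r ^ 3 := rfl
  simp only [tetraVolume_eq, h₀, h₁, h₂]
  ring

theorem hingeCoeff_reflection_eq_zero (a b c d : Fin 3 → ℝ) :
    hingeCoeff a b ((2 : ℝ) • c - d) c d = 0 := by
  have h : tetraVolume b ((2 : ℝ) • c - d) c d = 0 := by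
    simp only [tetraVolume_eq, Pi.sub_apply, Pi.smul_apply, smul_eq_mul]
    ring
  rw [hingeCoeff, h, zero_mul]

theorem hingeCoeff_reflection (a b c d : Fin 3 → ℝ) :
    hingeCoeff c d ((2 : ℝ) • c - d) a b = 2 * tetraVolume a b c d ^ 2 := by
  have h₁ : tetraVolume d ((2 : ℝ) • c - d) a b = -2 * tetraVolume a b c d := by
    simp only [tetraVolume_eq, Pi.sub_apply, Pi.smul_apply, smul_eq_mul]
    ring
  have h₂ : tetraVolume c ((2 : ℝ) • c - d) a b = -tetraVolume a b c d := by
    simp only [tetraVolume_eq, Pi.sub_apply, Pi.smul_apply, smul_eq_mul]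
    ring
  rw [hingeCoeff, h₁, h₂]
  ring

section Rows

variable [DecidableEq V]

/-- The span of the rows of the rigidity matrix of `(G, p)`. -/
def rowSpan (G : SimpleGraph V) (p : V → Fin 3 → ℝ) : Submodule ℝ (V × Fin 3 → ℝ) :=
  Submodule.span ℝ {w | ∃ x y, G.Adj x y ∧ w = rigidityRow p x y}

theorem rigidityRow_mem_rowSpan {G : SimpleGraph V} {x y : V} (h : G.Adj x y)
    (p : V → Fin 3 → ℝ) : rigidityRow p x y ∈ rowSpan G p :=
  Submodule.subset_span ⟨x, y, h, rfl⟩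

theorem rigidityRow_apply (p : V → Fin 3 → ℝ) (x y v : V) (k : Fin 3) :
    rigidityRow p x y (v, k) =
      ((if v = x then 1 else 0) - (if v = y then 1 else 0)) * (p x k - p y k) := by
  simp only [rigidityRow]
  split_ifs <;> ring

theorem rigidityRow_comm (p : V → Fin 3 → ℝ) (x y : V) :
    rigidityRow p x y = rigidityRow p y x := by
  funext vi
  simp only [rigidityRow]
  ring

/-- If `a, b, c, d, e` span a butterfly with hinges `{a, b}` and `{d, e}`, then a canonical
combination of the two hinge rows is spanned by the rows of the butterfly. -/
theorem butterfly_hinge_combination_mem {G : SimpleGraph V} (p : V → Fin 3 → ℝ) {a b c d e : V}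
    (hac : G.Adj a c) (had : G.Adj a d) (hae : G.Adj a e)
    (hbc : G.Adj b c) (hbd : G.Adj b d) (hbe : G.Adj b e)
    (hcd : G.Adj c d) (hce : G.Adj c e) :
    hingeCoeff (p a) (p b) (p c) (p d) (p e) • rigidityRow p a b +
      hingeCoeff (p d) (p e) (p c) (p a) (p b) • rigidityRow p d e ∈ rowSpan G p := by
  set la := tetraVolume (p b) (p c) (p d) (p e) with hla
  set lb := tetraVolume (p a) (p c) (p d) (p e) with hlb
  set lc := tetraVolume (p a) (p b) (p d) (p e) with hlc
  set ld := tetraVolume (p a) (p b) (p c) (p e) with hld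
  set le := tetraVolume (p a) (p b) (p c) (p d) with hle
  have h₁ : hingeCoeff (p a) (p b) (p c) (p d) (p e) = la * lb := rfl
  have h₂ : hingeCoeff (p d) (p e) (p c) (p a) (p b) = ld * le := by
    simp only [hingeCoeff, hld, hle, tetraVolume_eq]
    ring
  have hsum := tetraVolume_sum_eq_zero (p a) (p b) (p c) (p d) (p e)
  have hvec := tetraVolume_weighted_sum_eq_zero (p a) (p b) (p c) (p d) (p e)
  rw [← hla, ← hlb, ← hlc, ← hld, ← hle] at hsum
  simp only [← hla, ← hlb, ← hlc, ← hld, ← hle] at hvec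
  have key : (la * lb) • rigidityRow p a b + (ld * le) • rigidityRow p d e =
      (la * lc) • rigidityRow p a c + (-(la * ld)) • rigidityRow p a d +
      (la * le) • rigidityRow p a e + (-(lb * lc)) • rigidityRow p b c +
      (lb * ld) • rigidityRow p b d + (-(lb * le)) • rigidityRow p b e +
      (-(lc * ld)) • rigidityRow p c d + (lc * le) • rigidityRow p c e := by
    funext ⟨v, k⟩
    have hk := hvec k
    simp only [rigidityRow_apply, Pi.add_apply, Pi.smul_apply, smul_eq_mul]
    generalize (if v = a then (1 : ℝ) else 0) = δa
    generalize (if v = b then (1 : ℝ) else 0) = δb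
    generalize (if v = c then (1 : ℝ) else 0) = δc
    generalize (if v = d then (1 : ℝ) else 0) = δd
    generalize (if v = e then (1 : ℝ) else 0) = δe
    linear_combination
      (-(la * δa * p a k) + lb * δb * p b k - lc * δc * p c k + ld * δd * p d k
        - le * δe * p e k) * hsum +
      (la * δa - lb * δb + lc * δc - ld * δd + le * δe) * hk
  rw [h₁, h₂, key]
  have mem {x y : V} (h : G.Adj x y) (r : ℝ) : r • rigidityRow p x y ∈ rowSpan G p :=
    Submodule.smul_mem _ r (rigidityRow_mem_rowSpan h p)
  exact add_mem (add_mem (add_mem (add_mem (add_mem (add_mem (add_mem (mem hac _) (mem had _))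
    (mem hae _)) (mem hbc _)) (mem hbd _)) (mem hbe _)) (mem hcd _)) (mem hce _)

theorem rowSpan_mono {G H : SimpleGraph V} (h : G ≤ H) (p : V → Fin 3 → ℝ) :
    rowSpan G p ≤ rowSpan H p :=
  Submodule.span_mono fun _ ⟨x, y, hxy, hw⟩ => ⟨x, y, h hxy, hw⟩

theorem rowSpan_addEdge_of_mem {G : SimpleGraph V} {x y : V} {p : V → Fin 3 → ℝ}
    (h : rigidityRow p x y ∈ rowSpan G p) : rowSpan (addEdge G x y) p = rowSpan G p := by
  refine le_antisymm (Submodule.span_le.2 ?_) (rowSpan_mono le_sup_left p)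
  rintro _ ⟨u, v, huv, rfl⟩
  rcases huv with huv | huv
  · exact rigidityRow_mem_rowSpan huv p
  · rw [SimpleGraph.fromEdgeSet_adj, Set.mem_singleton_iff, Sym2.eq_iff] at huv
    rcases huv.1 with ⟨rfl, rfl⟩ | ⟨rfl, rfl⟩
    · exact h
    · rwa [rigidityRow_comm] at h

theorem rigidityRank_le_genRank [Finite V] (G : SimpleGraph V) (p : V → Fin 3 → ℝ) :
    rigidityRank G p ≤ genRank G := by
  have := Fintype.ofFinite V
  refine le_csSup ⟨Module.finrank ℝ (V × Fin 3 → ℝ), ?_⟩ ⟨p, rfl⟩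
  rintro _ ⟨q, rfl⟩
  exact Submodule.finrank_le _

theorem genRank_le {G : SimpleGraph V} {n : ℕ} (h : ∀ p, rigidityRank G p ≤ n) :
    genRank G ≤ n :=
  csSup_le ⟨_, 0, rfl⟩ (by rintro _ ⟨p, rfl⟩; exact h p)

theorem genRank_mono [Finite V] {G H : SimpleGraph V} (h : G ≤ H) : genRank G ≤ genRank H := by
  have := Fintype.ofFinite V
  exact genRank_le fun p =>
    (Submodule.finrank_mono (rowSpan_mono h p)).trans (rigidityRank_le_genRank H p)

open Filter Topology in
/-- The rank of the rigidity matrix is lower semicontinuous in the framework. -/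
theorem eventually_rigidityRank_le [Finite V] (G : SimpleGraph V) (p : V → Fin 3 → ℝ) :
    ∀ᶠ q in 𝓝 p, rigidityRank G p ≤ rigidityRank G q := by
  have := Fintype.ofFinite V
  let row (q : V → Fin 3 → ℝ) (e : {e : V × V // G.Adj e.1 e.2}) : V × Fin 3 → ℝ :=
    rigidityRow q e.1.1 e.1.2
  have hrow (q : V → Fin 3 → ℝ) : rowSpan G q = Submodule.span ℝ (Set.range (row q)) := by
    unfold rowSpan
    congr 1
    ext w
    constructor
    · rintro ⟨x, y, h, rfl⟩
      exact ⟨⟨(x, y), h⟩, rfl⟩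
    · rintro ⟨⟨⟨x, y⟩, h⟩, rfl⟩
      exact ⟨x, y, h, rfl⟩
  obtain ⟨κ, f, hf, hspan, hli⟩ := exists_linearIndependent' ℝ (row p)
  have : Finite κ := Finite.of_injective f hf
  have := Fintype.ofFinite κ
  have hcont : Continuous fun q : V → Fin 3 → ℝ => row q ∘ f := by
    refine continuous_pi fun k => continuous_pi fun vi => ?_
    simp only [row, rigidityRow, Function.comp_apply]
    refine Continuous.add ?_ ?_ <;> split_ifs <;> fun_prop
  have hopen := (isOpen_setOfPred_linearIndependent (𝕜 := ℝ) (ι := κ)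
    (E := V × Fin 3 → ℝ)).preimage hcont
  filter_upwards [hopen.mem_nhds hli] with q hq
  have hcard : rigidityRank G p = Fintype.card κ := by
    change Module.finrank ℝ (rowSpan G p) = _
    rw [hrow, ← hspan, finrank_span_eq_card hli]
  have hle : Submodule.span ℝ (Set.range (row q ∘ f)) ≤ rowSpan G q := by
    rw [hrow]
    exact Submodule.span_mono (Set.range_comp_subset_range f (row q))
  rw [hcard, ← finrank_span_eq_card (b := row q ∘ f) hq]
  exact Submodule.finrank_mono hle

open Filter Topology in
/-- If a pair's row is spanned by the rows of `G` wherever `P` does not vanish, and `P` is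
analytic along lines and does not vanish identically, then adding the pair to `G` does not
change the generic rank. -/
theorem genRank_addEdge_of_generic [Finite V] {G : SimpleGraph V} {x y : V}
    (P : (V → Fin 3 → ℝ) → ℝ)
    (hP : ∀ p q : V → Fin 3 → ℝ,
      AnalyticOnNhd ℝ (fun t : ℝ => P fun v k => p v k + t * (q v k - p v k)) Set.univ)
    (hne : ∃ q, P q ≠ 0) (hspan : ∀ p, P p ≠ 0 → rigidityRow p x y ∈ rowSpan G p) :
    genRank (addEdge G x y) = genRank G := by
  refine le_antisymm (genRank_le fun p => ?_) (genRank_mono le_sup_left)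
  obtain ⟨q, hq⟩ := hne
  let line (t : ℝ) : V → Fin 3 → ℝ := fun v k => p v k + t * (q v k - p v k)
  have hline : Continuous line := by fun_prop
  have hline₀ : line 0 = p := by ext; simp [line]
  have hline₁ : line 1 = q := by ext; simp [line]
  have hfreq : ∃ᶠ t in 𝓝 (0 : ℝ), P (line t) ≠ 0 := by
    intro hzero
    refine hq ?_
    have := (hP p q).eqOn_zero_of_preconnected_of_eventuallyEq_zero isPreconnected_univ
      (Set.mem_univ 0) (hzero.mono fun t ht => not_not.1 ht) (Set.mem_univ 1)
    rw [← hline₁]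
    exact this
  have hrank : ∀ᶠ t in 𝓝 (0 : ℝ),
      rigidityRank (addEdge G x y) p ≤ rigidityRank (addEdge G x y) (line t) :=
    hline.continuousAt.eventually
      (by rw [hline₀]; exact eventually_rigidityRank_le (addEdge G x y) p)
  obtain ⟨t, ht, hle⟩ := (hfreq.and_eventually hrank).exists
  calc rigidityRank (addEdge G x y) p
      ≤ Module.finrank ℝ (rowSpan (addEdge G x y) (line t)) := hle
    _ = rigidityRank G (line t) := by rw [rowSpan_addEdge_of_mem (hspan _ ht)]; rfl
    _ ≤ genRank G := rigidityRank_le_genRank G (line t)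

end Rows

/-- Telescoping of relations between cyclically consecutive elements modulo a submodule. -/
theorem cyclic_relation_mem {R M : Type*} [CommRing R] [AddCommGroup M] [Module R M] {m : ℕ}
    (W : Submodule R M) (A B : ZMod m → R) (h : ZMod m → M)
    (hW : ∀ j, A j • h j + B j • h (j + 1) ∈ W) (i : ZMod m) (n : ℕ) :
    (∏ k ∈ Finset.range n, A (i + k)) • h i -
      ((-1) ^ n * ∏ k ∈ Finset.range n, B (i + k)) • h (i + n) ∈ W := by
  induction n with
  | zero => simp
  | succ n ih =>
    have h₁ := W.smul_mem (A (i + n)) ih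
    have h₂ := W.smul_mem ((-1) ^ n * ∏ k ∈ Finset.range n, B (i + k)) (hW (i + n))
    convert add_mem h₁ h₂ using 1
    rw [Finset.prod_range_succ, Finset.prod_range_succ, Nat.cast_succ, ← add_assoc]
    module

/-- A framework on the vertices of the ring of butterflies with hinge endpoints on the moment
curve, in which the middle vertex of each link lies on the line through one of its hinges. -/
def momentFramework (m : ℕ) (x : ZMod m × Fin 3) : Fin 3 → ℝ :=
  ![momentCurve (2 * x.1.val), momentCurve (2 * x.1.val + 1),
    (2 : ℝ) • momentCurve (2 * (x.1 + 1).val) - momentCurve (2 * (x.1 + 1).val + 1)] x.2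

theorem tetraVolume_momentFramework_ne_zero {m : ℕ} (hm : 2 ≤ m) (j : ZMod m) :
    tetraVolume (momentFramework m (j, 0)) (momentFramework m (j, 1))
      (momentFramework m (j + 1, 0)) (momentFramework m (j + 1, 1)) ≠ 0 := by
  have : Fact (1 < m) := ⟨hm⟩
  have : NeZero m := ⟨by omega⟩
  have hne : (j + 1).val ≠ j.val := fun h => by
    have := ZMod.val_injective m h
    simp at this
  simp only [momentFramework, Matrix.cons_val, tetraVolume_momentCurve]
  generalize (j + 1).val = r at hne
  generalize j.val = s at hne
  have hcast (x : ℤ) (hx : x ≠ 0) (y : ℝ) (hy : y = x) : y ≠ 0 := by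
    rw [hy]; exact_mod_cast hx
  refine mul_ne_zero (mul_ne_zero (mul_ne_zero (mul_ne_zero (mul_ne_zero ?_ ?_) ?_) ?_) ?_) ?_
  · exact hcast 1 (by omega) _ (by push_cast; ring)
  · exact hcast (2 * r - 2 * s) (by omega) _ (by push_cast; ring)
  · exact hcast (2 * r - 2 * s + 1) (by omega) _ (by push_cast; ring)
  · exact hcast (2 * r - 2 * s - 1) (by omega) _ (by push_cast; ring)
  · exact hcast (2 * r - 2 * s) (by omega) _ (by push_cast; ring)
  · exact hcast 1 (by omega) _ (by push_cast; ring)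

theorem butterflyRing_not_adj_hinge {m : ℕ} (hm : 2 ≤ m) (i : ZMod m) :
    ¬ (butterflyRing m).Adj (i, 0) (i, 1) := by
  have : Fact (1 < m) := ⟨hm⟩
  simp [butterflyRing]

theorem butterflyRing_adj_apex {m : ℕ} (i : ZMod m) {k : Fin 3} (hk : k ≠ 2) :
    (butterflyRing m).Adj (i, k) (i, 2) := by
  simp [butterflyRing, hk]

theorem butterflyRing_adj_succ {m : ℕ} (hm : 2 ≤ m) (i : ZMod m) (k : Fin 3) {l : Fin 3}
    (hl : l ≠ 2) : (butterflyRing m).Adj (i, k) (i + 1, l) := by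
  have : Fact (1 < m) := ⟨hm⟩
  simp [butterflyRing, hl]

/-- In a ring of butterflies `R_m` with `m ≥ 3` links, every hinge
`{aᵢ, bᵢ}` is an implied nonedge, i.e. `rank₃(R_m + {aᵢ,bᵢ}) = rank₃(R_m)`. -/
theorem ringOfButterflies_hinge_implied {V : Type*} [DecidableEq V]
    (m : ℕ) (hm : 3 ≤ m) (G : SimpleGraph V) (a b : ZMod m → V)
    (hring : IsRingOfButterflies m G a b) (i : ZMod m) :
    ImpliedNonedge G (a i) (b i) := by
  obtain ⟨φ, ha, hb⟩ := hring
  have hm₂ : 2 ≤ m := by omega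
  have : NeZero m := ⟨by omega⟩
  have : Finite V := Finite.of_equiv _ φ.symm.toEquiv
  refine ⟨fun h => ?_, fun h => ?_, ?_⟩
  · have := congrArg φ h
    simp [ha, hb] at this
  · rw [← φ.map_adj_iff, ha, hb] at h
    exact butterflyRing_not_adj_hinge hm₂ i h
  let c (j : ZMod m) : V := φ.symm (j, 2)
  have hc (j : ZMod m) : φ (c j) = (j, 2) := φ.apply_symm_apply _
  let A (p : V → Fin 3 → ℝ) (j : ZMod m) : ℝ :=
    hingeCoeff (p (a j)) (p (b j)) (p (c j)) (p (a (j + 1))) (p (b (j + 1)))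
  let B (p : V → Fin 3 → ℝ) (j : ZMod m) : ℝ :=
    hingeCoeff (p (a (j + 1))) (p (b (j + 1))) (p (c j)) (p (a j)) (p (b j))
  refine genRank_addEdge_of_generic (fun p => (∏ k ∈ Finset.range m, A p (i + k)) -
    (-1) ^ m * ∏ k ∈ Finset.range m, B p (i + k)) ?_ ?_ ?_
  · intro p q t _
    simp only [A, B, hingeCoeff, tetraVolume_eq]
    refine AnalyticAt.sub ?_ (AnalyticAt.mul analyticAt_const ?_) <;>
    · refine Finset.analyticAt_fun_prod _ fun k _ => ?_
      fun_prop
  · refine ⟨fun v => momentFramework m (φ v), ?_⟩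
    have hc' (j : ZMod m) : momentFramework m (j, 2) =
        (2 : ℝ) • momentFramework m (j + 1, 0) - momentFramework m (j + 1, 1) := rfl
    simp only [A, B, ha, hb, hc, hc', hingeCoeff_reflection_eq_zero, hingeCoeff_reflection]
    rw [Finset.prod_eq_zero (Finset.mem_range.2 (by omega : 0 < m)) rfl, zero_sub, neg_ne_zero]
    refine mul_ne_zero (pow_ne_zero _ (by norm_num)) (Finset.prod_ne_zero_iff.2 fun k _ => ?_)
    exact mul_ne_zero (by norm_num)
      (pow_ne_zero _ (tetraVolume_momentFramework_ne_zero hm₂ _))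
  · intro p hp
    have key := cyclic_relation_mem (rowSpan G p) (A p) (B p)
      (fun j => rigidityRow p (a j) (b j)) (fun j => by
        apply butterfly_hinge_combination_mem p <;>
          rw [← φ.map_adj_iff] <;> simp only [ha, hb, hc]
        · exact butterflyRing_adj_apex j (by decide)
        · exact butterflyRing_adj_succ hm₂ j 0 (by decide)
        · exact butterflyRing_adj_succ hm₂ j 0 (by decide)
        · exact butterflyRing_adj_apex j (by decide)
        · exact butterflyRing_adj_succ hm₂ j 1 (by decide)
        · exact butterflyRing_adj_succ hm₂ j 1 (by decide)
        · exact butterflyRing_adj_succ hm₂ j 2 (by decide)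
        · exact butterflyRing_adj_succ hm₂ j 2 (by decide)) i m
    rw [ZMod.natCast_self, add_zero, ← sub_smul] at key
    exact (Submodule.smul_mem_iff _ hp).1 key

end Rigidity
end
end

section
/- Every ring of butterflies R_m with m ≥ 6 links is independent, i.e., rank₃(R_m) = |E(R_m)| = 8m; consequently R_m has exactly m − 6 independent flexes, i.e., 3|V(R_m)| − 6 − rank₃(R_m) = m − 6. -/
noncomputable section

open scoped RealInnerProductSpace

namespace Rigidity

variable {V : Type*}

/-- Cramer's rule in `ℝ³`: three vectors with nonzero determinant satisfy no nontrivial linear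
relation. -/
lemma eq_zero_of_det_ne_zero {u v w : Fin 3 → ℝ} (hD : (Matrix.of ![u, v, w]).det ≠ 0)
    {x y z : ℝ} (h : ∀ d, x * u d + y * v d + z * w d = 0) : x = 0 ∧ y = 0 ∧ z = 0 := by
  rw [Matrix.det_fin_three] at hD
  simp only [Matrix.of_apply, Matrix.cons_val] at hD
  have h0 := h 0
  have h1 := h 1
  have h2 := h 2
  refine ⟨?_, ?_, ?_⟩ <;> refine (mul_eq_zero.mp ?_).resolve_right hD
  · linear_combination h0 * (v 1 * w 2 - v 2 * w 1) - h1 * (v 0 * w 2 - v 2 * w 0) +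
      h2 * (v 0 * w 1 - v 1 * w 0)
  · linear_combination -h0 * (u 1 * w 2 - u 2 * w 1) + h1 * (u 0 * w 2 - u 2 * w 0) -
      h2 * (u 0 * w 1 - u 1 * w 0)
  · linear_combination h0 * (u 1 * v 2 - u 2 * v 1) - h1 * (u 0 * v 2 - u 2 * v 0) +
      h2 * (u 0 * v 1 - u 1 * v 0)

/-- The stresses on a butterfly with hinges `{a, b}`, `{a', b'}` and apex
`e = a + b - (a' + b') / 2` that exert opposite forces along each hinge: they are the
restrictions of the self-stresses of `K₅`. -/
lemma butterfly_stress {a b a' b' e : Fin 3 → ℝ} (s : Fin 8 → ℝ) (τ τ' : ℝ)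
    (hD : (Matrix.of ![a - a', b - a', b' - a']).det ≠ 0)
    (he : ∀ d, e d = a d + b d - (a' d + b' d) / 2)
    (hE : ∀ d, s 0 * (e d - a d) + s 1 * (e d - b d) + s 6 * (e d - a' d) +
      s 7 * (e d - b' d) = 0)
    (hA : ∀ d, s 0 * (a d - e d) + s 2 * (a d - a' d) + s 3 * (a d - b' d) =
      τ * (a d - b d))
    (hB : ∀ d, s 1 * (b d - e d) + s 4 * (b d - a' d) + s 5 * (b d - b' d) =
      -τ * (a d - b d))
    (hA' : ∀ d, s 2 * (a' d - a d) + s 4 * (a' d - b d) + s 6 * (a' d - e d) =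
      -τ' * (a' d - b' d)) :
    τ' = -τ / 4 ∧ (τ = 0 → s = 0) := by
  simp only [he] at hE hA hB hA'
  obtain ⟨a1, a2, a3⟩ := eq_zero_of_det_ne_zero hD (x := s 2 + s 3 - τ) (y := τ - s 0)
    (z := s 0 / 2 - s 3) fun d => by
      simp only [Pi.sub_apply]; linear_combination hA d
  obtain ⟨b1, b2, b3⟩ := eq_zero_of_det_ne_zero hD (x := τ - s 1) (y := s 4 + s 5 - τ)
    (z := s 1 / 2 - s 5) fun d => by
      simp only [Pi.sub_apply]; linear_combination hB d
  obtain ⟨e1, e2, e3⟩ := eq_zero_of_det_ne_zero hD (x := s 1 + s 6 + s 7)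
    (y := s 0 + s 6 + s 7) (z := - s 0 / 2 - s 1 / 2 - s 6 / 2 - 3 * s 7 / 2) fun d => by
      simp only [Pi.sub_apply]; linear_combination hE d
  obtain ⟨c1, c2, c3⟩ := eq_zero_of_det_ne_zero hD (x := - s 2 - s 6) (y := - s 4 - s 6)
    (z := s 6 / 2 - τ') fun d => by
      simp only [Pi.sub_apply]; linear_combination hA' d
  refine ⟨by linarith, fun hτ => funext fun k => ?_⟩
  fin_cases k <;> simp <;> linarith

/-- A function on a cycle that is multiplied at each step by a factor of absolute value other
than one vanishes. -/
lemma eq_zero_of_succ_eq {m : ℕ} [NeZero m] {τ : ZMod m → ℝ} {r : ℝ} (hr : |r| ≠ 1)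
    (h : ∀ i, τ (i + 1) = r * τ i) : τ = 0 := by
  have h1 : ∑ i, |τ i| = |r| * ∑ i, |τ i| := by
    rw [Finset.mul_sum, ← Equiv.sum_comp (Equiv.addRight (1 : ZMod m))]
    exact Finset.sum_congr rfl fun i _ => by simp [h, abs_mul]
  have h2 : ∑ i, |τ i| = 0 := by
    refine (mul_eq_zero.mp (?_ : (1 - |r|) * ∑ i, |τ i| = 0)).resolve_left
      (sub_ne_zero.mpr hr.symm)
    linear_combination h1
  ext i
  simpa using (Finset.sum_eq_zero_iff_of_nonneg fun i _ => abs_nonneg (τ i)).mp h2 i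

lemma eq_of_succ_eq {m : ℕ} {α : Type*} {f : ZMod m → α} (h : ∀ i, f (i + 1) = f i)
    (i j : ZMod m) : f i = f j := by
  have key : ∀ i : ZMod m, f i = f 0 := fun i => by
    obtain ⟨n, rfl⟩ := ZMod.intCast_surjective i
    induction n using Int.induction_on with
    | zero => simp
    | succ n ih => rw [← ih, ← h (n : ℤ)]; push_cast; rfl
    | pred n ih => rw [← ih, ← h]; push_cast; congr 1; ring
  rw [key i, key j]

/-- The end points of the eight edges of the `i`-th link of the canonical ring of
butterflies. -/
def linkEdge {m : ℕ} (e : ZMod m × Fin 8) : (ZMod m × Fin 3) × (ZMod m × Fin 3) :=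
  let i := e.1
  ![((i, 2), (i, 0)), ((i, 2), (i, 1)), ((i, 0), (i + 1, 0)), ((i, 0), (i + 1, 1)),
    ((i, 1), (i + 1, 0)), ((i, 1), (i + 1, 1)), ((i, 2), (i + 1, 0)),
    ((i, 2), (i + 1, 1))] e.2

/-- The framework of the canonical ring of butterflies with hinge vertices at `a i`, `b i`, in
which the apex of link `i` is at `a i + b i - (a (i + 1) + b (i + 1)) / 2`. -/
def ringFramework {m : ℕ} (a b : ZMod m → Fin 3 → ℝ) (x : ZMod m × Fin 3) : Fin 3 → ℝ :=
  ![a x.1, b x.1, fun d => a x.1 d + b x.1 d - (a (x.1 + 1) d + b (x.1 + 1) d) / 2] x.2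

/-- If the hinge lines span the space of lines and consecutive hinges are not coplanar, then
the rows of the rigidity matrix of `ringFramework a b` are linearly independent. -/
lemma linearIndependent_rigidityRow {m : ℕ} [NeZero m] (a b : ZMod m → Fin 3 → ℝ)
    (hD : ∀ i, (Matrix.of ![a i - a (i + 1), b i - a (i + 1), b (i + 1) - a (i + 1)]).det ≠ 0)
    (hab : ∀ i, a i 0 ≠ b i 0)
    (hspan : ∀ F T : Fin 3 → ℝ,
      (∀ i, F ⬝ᵥ crossProduct (a i) (b i) + T ⬝ᵥ (b i - a i) = 0) → F = 0 ∧ T = 0) :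
    LinearIndependent ℝ fun e : ZMod m × Fin 8 =>
      rigidityRow (ringFramework a b) (linkEdge e).1 (linkEdge e).2 := by
  rw [Fintype.linearIndependent_iff]
  intro c hc
  set p := ringFramework a b with hp
  set e : ZMod m → Fin 3 → ℝ := fun i => p (i, 2) with he
  -- the forces exerted by link `i` on its vertices `a i`, `b i`, `a (i + 1)`, `b (i + 1)`
  set A : ZMod m → Fin 3 → ℝ := fun i d => c (i, 0) * (a i d - e i d) +
    c (i, 2) * (a i d - a (i + 1) d) + c (i, 3) * (a i d - b (i + 1) d) with hA
  set B : ZMod m → Fin 3 → ℝ := fun i d => c (i, 1) * (b i d - e i d) +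
    c (i, 4) * (b i d - a (i + 1) d) + c (i, 5) * (b i d - b (i + 1) d) with hB
  set A' : ZMod m → Fin 3 → ℝ := fun i d => c (i, 2) * (a (i + 1) d - a i d) +
    c (i, 4) * (a (i + 1) d - b i d) + c (i, 6) * (a (i + 1) d - e i d) with hA'
  set B' : ZMod m → Fin 3 → ℝ := fun i d => c (i, 3) * (b (i + 1) d - a i d) +
    c (i, 5) * (b (i + 1) d - b i d) + c (i, 7) * (b (i + 1) d - e i d) with hB'
  have hpa : ∀ i, p (i, 0) = a i := fun i => rfl
  have hpb : ∀ i, p (i, 1) = b i := fun i => rfl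
  have hpe : ∀ i, p (i, 2) = e i := fun i => rfl
  have hE : ∀ i d, c (i, 0) * (e i d - a i d) + c (i, 1) * (e i d - b i d) +
      c (i, 6) * (e i d - a (i + 1) d) + c (i, 7) * (e i d - b (i + 1) d) = 0 := fun i d => by
    have h := congrFun hc ((i, 2), d)
    simp [Fintype.sum_prod_type, Fin.sum_univ_eight, linkEdge, rigidityRow,
      Finset.sum_add_distrib, mul_add, hpa, hpb, hpe] at h
    linear_combination h
  have hAA : ∀ i d, A (i + 1) d = - A' i d := fun i d => by
    have h := congrFun hc ((i + 1, 0), d)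
    simp [Fintype.sum_prod_type, Fin.sum_univ_eight, linkEdge, rigidityRow,
      Finset.sum_add_distrib, mul_add, hpa, hpb, hpe] at h
    simp only [hA, hA']
    linear_combination h
  have hBB : ∀ i d, B (i + 1) d = - B' i d := fun i d => by
    have h := congrFun hc ((i + 1, 1), d)
    simp [Fintype.sum_prod_type, Fin.sum_univ_eight, linkEdge, rigidityRow,
      Finset.sum_add_distrib, mul_add, hpa, hpb, hpe] at h
    simp only [hB, hB']
    linear_combination h
  -- the wrench transmitted through the hinges is constant, hence zero
  have hF : ∀ i, A (i + 1) + B (i + 1) = A i + B i := fun i => by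
    ext d
    simp only [Pi.add_apply, hAA, hBB]
    simp only [hA, hA', hB, hB']
    linear_combination hE i d
  have hT : ∀ i, crossProduct (a (i + 1)) (A (i + 1)) + crossProduct (b (i + 1)) (B (i + 1)) =
      crossProduct (a i) (A i) + crossProduct (b i) (B i) := fun i => by
    have h0 := hE i 0
    have h1 := hE i 1
    have h2 := hE i 2
    ext d
    fin_cases d <;> simp [cross_apply, hAA, hBB] <;> simp only [hA, hA', hB, hB']
    · linear_combination e i 1 * h2 - e i 2 * h1
    · linear_combination e i 2 * h0 - e i 0 * h2
    · linear_combination e i 0 * h1 - e i 1 * h0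
  obtain ⟨hF0, hT0⟩ := hspan (A 0 + B 0) (crossProduct (a 0) (A 0) + crossProduct (b 0) (B 0))
    fun i => by
      rw [eq_of_succ_eq (f := fun i => A i + B i) hF 0 i, eq_of_succ_eq
        (f := fun i => crossProduct (a i) (A i) + crossProduct (b i) (B i)) hT 0 i]
      simp [cross_apply, dotProduct, Fin.sum_univ_three]
      ring
  have hF1 : ∀ i d, B i d = - A i d := fun i d => by
    have h := congrFun ((eq_of_succ_eq (f := fun i => A i + B i) hF i 0).trans hF0) d
    simp only [Pi.add_apply, Pi.zero_apply] at h
    linear_combination h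
  have hT1 : ∀ i, crossProduct (a i) (A i) + crossProduct (b i) (B i) = 0 := fun i =>
    (eq_of_succ_eq (f := fun i => crossProduct (a i) (A i) + crossProduct (b i) (B i))
      hT i 0).trans hT0
  set τ : ZMod m → ℝ := fun i => A i 0 / (a i 0 - b i 0) with hτ
  have hAτ : ∀ i d, A i d = τ i * (a i d - b i d) := fun i d => by
    have h1 := congrFun (hT1 i) 1
    have h2 := congrFun (hT1 i) 2
    simp [cross_apply, hF1] at h1 h2
    have h0 := sub_ne_zero.mpr (hab i)
    simp only [hτ]
    fin_cases d <;> simp <;> field_simp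
    · linear_combination h2
    · linear_combination -h1
  have hlink := fun i => butterfly_stress (a := a i) (b := b i) (a' := a (i + 1))
    (b' := b (i + 1)) (e := e i) (fun k => c (i, k)) (τ i) (τ (i + 1)) (hD i)
    (fun d => rfl) (hE i) (hAτ i) (fun d => by linear_combination hF1 i d - hAτ i d)
    (fun d => by linear_combination hAA i d - hAτ (i + 1) d)
  have hτ0 : τ = 0 := eq_zero_of_succ_eq (r := -1 / 4) (by norm_num [abs_div]) fun i => by
    rw [(hlink i).1]; ring
  rintro ⟨i, k⟩
  exact congrFun ((hlink i).2 (congrFun hτ0 i)) k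

lemma butterflyRing_adj_iff {m : ℕ} (hm : m ≠ 1) (x y : ZMod m × Fin 3) :
    (butterflyRing m).Adj x y ↔ ∃ e, linkEdge e = (x, y) ∨ linkEdge e = (y, x) := by
  have hne : (1 : ZMod m) ≠ 0 := fun h => hm (by
    simpa using (ZMod.natCast_eq_zero_iff 1 m).mp (by exact_mod_cast h))
  have hadj : ∀ e : ZMod m × Fin 8, (butterflyRing m).Adj (linkEdge e).1 (linkEdge e).2 := by
    rintro ⟨i, k⟩
    fin_cases k <;> simp [butterflyRing, linkEdge, hne]
  have hedge : ∀ x y : ZMod m × Fin 3,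
      (x.1 = y.1 ∧ x ≠ y ∧ (x.2 = 2 ∨ y.2 = 2)) ∨ (y.1 = x.1 + 1 ∧ y.2 ≠ 2) →
        ∃ e, linkEdge e = (x, y) ∨ linkEdge e = (y, x) := by
    rintro ⟨i, s⟩ ⟨j, t⟩ (⟨rfl, h1, h2⟩ | ⟨rfl, h⟩)
    · refine ⟨(i, if s = 0 ∨ t = 0 then 0 else 1), ?_⟩
      fin_cases s <;> fin_cases t <;> simp_all [linkEdge]
    · refine ⟨(i, ![![2, 3, 0], ![4, 5, 0], ![6, 7, 0]] s t), ?_⟩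
      fin_cases s <;> fin_cases t <;> simp_all [linkEdge]
  constructor
  · rintro ⟨-, h | h⟩
    · exact hedge x y h
    · obtain ⟨e, he⟩ := hedge y x h
      exact ⟨e, he.symm⟩
  · rintro ⟨e, he | he⟩
    · simpa [he] using hadj e
    · simpa [he] using (hadj e).symm

lemma rigidityRow_symm [DecidableEq V] (p : V → Fin 3 → ℝ) (x y : V) :
    rigidityRow p x y = rigidityRow p y x := by
  ext v
  simp only [rigidityRow]
  ring

lemma rigidityRank_butterflyRing {m : ℕ} (hm : m ≠ 1) (p : ZMod m × Fin 3 → Fin 3 → ℝ) :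
    rigidityRank (butterflyRing m) p = Module.finrank ℝ (Submodule.span ℝ
      (Set.range fun e : ZMod m × Fin 8 => rigidityRow p (linkEdge e).1 (linkEdge e).2)) := by
  refine congrArg (fun S => Module.finrank ℝ (Submodule.span ℝ S)) (Set.ext fun w => ?_)
  simp only [butterflyRing_adj_iff hm, Set.mem_ofPred_eq, Set.mem_range]
  constructor
  · rintro ⟨x, y, ⟨e, he | he⟩, rfl⟩
    · exact ⟨e, by rw [he]⟩
    · exact ⟨e, by rw [he, rigidityRow_symm]⟩
  · rintro ⟨e, rfl⟩
    exact ⟨_, _, ⟨e, Or.inl rfl⟩, rfl⟩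

/-- Placing the hinge vertices of a ring of at least six butterflies on the twisted cubic gives
a framework whose rigidity matrix has linearly independent rows. -/
lemma exists_linearIndependent_rigidityRow {m : ℕ} (hm : 6 ≤ m) :
    ∃ p : ZMod m × Fin 3 → Fin 3 → ℝ, LinearIndependent ℝ fun e : ZMod m × Fin 8 =>
      rigidityRow p (linkEdge e).1 (linkEdge e).2 := by
  have : NeZero m := ⟨by lia⟩
  have : Fact (1 < m) := ⟨by lia⟩
  refine ⟨_, linearIndependent_rigidityRow (fun i d => (i.val : ℝ) ^ (d.val + 1))
    (fun i d => (-(1 + (i.val : ℝ) ^ 2)) ^ (d.val + 1)) ?_ ?_ ?_⟩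
  · intro i
    have hne : i.val ≠ (i + 1).val := fun h => by simpa using ZMod.val_injective m h
    generalize i.val = x at hne
    generalize (i + 1).val = y at hne
    have hne' : (x : ℝ) ≠ y := by exact_mod_cast hne
    have hx : (0 : ℝ) ≤ x := x.cast_nonneg
    have hy : (0 : ℝ) ≤ y := y.cast_nonneg
    have key : ((x : ℝ) - y) * (1 + x ^ 2 + y) * (1 + x ^ 2 + x) * (1 + y ^ 2 + x) *
        (1 + y ^ 2 + y) * ((x - y) * (x + y)) ≠ 0 := by
      have h1 : (x : ℝ) + y ≠ 0 := by
        intro h; exact hne' (by linarith)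
      have h2 := sub_ne_zero.mpr hne'
      have : (1 + x ^ 2 + y : ℝ) ≠ 0 := by positivity
      have : (1 + x ^ 2 + x : ℝ) ≠ 0 := by positivity
      have : (1 + y ^ 2 + x : ℝ) ≠ 0 := by positivity
      have : (1 + y ^ 2 + y : ℝ) ≠ 0 := by positivity
      simp_all
    rw [Matrix.det_fin_three]
    simp
    contrapose! key
    linear_combination key
  · intro i
    have : (0 : ℝ) ≤ i.val := Nat.cast_nonneg _
    simp
    nlinarith
  · intro F T h
    have hval : ∀ k < 6, ((k : ℕ) : ZMod m).val = k := fun k hk =>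
      ZMod.val_natCast_of_lt (by lia)
    have h0 := h (0 : ℕ)
    have h1 := h (1 : ℕ)
    have h2 := h (2 : ℕ)
    have h3 := h (3 : ℕ)
    have h4 := h (4 : ℕ)
    have h5 := h (5 : ℕ)
    simp only [hval _ (by norm_num : 0 < 6), hval _ (by norm_num : 1 < 6),
      hval _ (by norm_num : 2 < 6), hval _ (by norm_num : 3 < 6), hval _ (by norm_num : 4 < 6),
      hval _ (by norm_num : 5 < 6)] at h0 h1 h2 h3 h4 h5
    simp only [cross_apply, dotProduct, Fin.sum_univ_three, Matrix.cons_val] at h0 h1 h2 h3 h4 h5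
    norm_num at h0 h1 h2 h3 h4 h5
    constructor <;> ext d <;> fin_cases d <;> simp <;> linarith

lemma genRank_eq_of_iso {W : Type*} [DecidableEq V] [DecidableEq W] {G : SimpleGraph V}
    {H : SimpleGraph W} (φ : G ≃g H) : genRank G = genRank H := by
  have key : ∀ p : W → Fin 3 → ℝ, rigidityRank H p = rigidityRank G (p ∘ φ) := fun p => by
    unfold rigidityRank
    rw [← (LinearEquiv.funCongrLeft ℝ ℝ
      (φ.toEquiv.prodCongr (Equiv.refl (Fin 3)))).finrank_map_eq, Submodule.map_span]
    have hrow : ∀ x y, LinearEquiv.funCongrLeft ℝ ℝ (φ.toEquiv.prodCongr (Equiv.refl (Fin 3)))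
        (rigidityRow p (φ x) (φ y)) = rigidityRow (p ∘ φ) x y := fun x y => by
      ext v
      simp [rigidityRow, LinearEquiv.funCongrLeft, LinearMap.funLeft]
    refine congrArg (fun S => Module.finrank ℝ (Submodule.span ℝ S)) (Set.ext fun w => ?_)
    constructor
    · rintro ⟨_, ⟨x, y, hxy, rfl⟩, rfl⟩
      obtain ⟨x, rfl⟩ := φ.surjective x
      obtain ⟨y, rfl⟩ := φ.surjective y
      exact ⟨x, y, φ.map_adj_iff.mp hxy, hrow x y⟩
    · rintro ⟨x, y, hxy, rfl⟩
      exact ⟨_, ⟨φ x, φ y, φ.map_adj_iff.mpr hxy, rfl⟩, hrow x y⟩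
  unfold genRank
  congr 1
  ext n
  constructor
  · rintro ⟨p, rfl⟩
    exact ⟨p ∘ φ.symm, by rw [key]; congr; ext; simp⟩
  · rintro ⟨p, rfl⟩
    exact ⟨p ∘ φ, key p⟩

lemma genRank_butterflyRing {m : ℕ} (hm : 6 ≤ m) : genRank (butterflyRing m) = 8 * m := by
  have : NeZero m := ⟨by lia⟩
  have hcard : Fintype.card (ZMod m × Fin 8) = 8 * m := by
    simp [ZMod.card, mul_comm]
  refine IsGreatest.csSup_eq ⟨?_, ?_⟩
  · obtain ⟨p, hp⟩ := exists_linearIndependent_rigidityRow hm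
    exact ⟨p, by rw [rigidityRank_butterflyRing (by lia), finrank_span_eq_card hp, hcard]⟩
  · rintro n ⟨p, rfl⟩
    rw [rigidityRank_butterflyRing (by lia), ← hcard]
    exact finrank_range_le_card _

lemma ncard_edgeSet_butterflyRing {m : ℕ} (hm : 6 ≤ m) :
    (butterflyRing m).edgeSet.ncard = 8 * m := by
  have : NeZero m := ⟨by lia⟩
  obtain ⟨p, hp⟩ := exists_linearIndependent_rigidityRow hm
  have hinj : Function.Injective fun e : ZMod m × Fin 8 => s((linkEdge e).1, (linkEdge e).2) := by
    intro e f hef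
    refine hp.injective ?_
    rcases Sym2.eq_iff.mp hef with ⟨h1, h2⟩ | ⟨h1, h2⟩
    · simp only [h1, h2]
    · simp only [h1, h2, rigidityRow_symm p (linkEdge f).1]
  have hrange : (butterflyRing m).edgeSet =
      Set.range fun e : ZMod m × Fin 8 => s((linkEdge e).1, (linkEdge e).2) := by
    ext z
    induction z with
    | h x y =>
      simp only [SimpleGraph.mem_edgeSet, butterflyRing_adj_iff (by lia : m ≠ 1), Set.mem_range,
        Sym2.eq_iff, Prod.ext_iff]
  rw [hrange, ← Set.image_univ, Set.ncard_image_of_injective _ hinj, Set.ncard_univ]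
  simp [Nat.card_eq_fintype_card, ZMod.card, mul_comm]

/-- Every ring of butterflies `R_m` with `m ≥ 6` links is independent,
i.e. `rank₃(R_m) = |E(R_m)| = 8m`; consequently it has exactly `m - 6` independent
flexes, i.e. `3|V(R_m)| - 6 - rank₃(R_m) = m - 6`. -/
theorem ringOfButterflies_independent {V : Type*} [DecidableEq V]
    (m : ℕ) (hm : 6 ≤ m) (G : SimpleGraph V) (a b : ZMod m → V)
    (hring : IsRingOfButterflies m G a b) :
    IsIndependent G ∧ genRank G = 8 * m ∧ G.edgeSet.ncard = 8 * m ∧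
      3 * Nat.card V - 6 - genRank G = m - 6 := by
  obtain ⟨φ, -, -⟩ := hring
  have hrank : genRank G = 8 * m := (genRank_eq_of_iso φ).trans (genRank_butterflyRing hm)
  have hedge : G.edgeSet.ncard = 8 * m :=
    (Nat.card_congr φ.mapEdgeSet).trans (ncard_edgeSet_butterflyRing hm)
  have hcard : Nat.card V = 3 * m := by
    rw [Nat.card_congr φ.toEquiv]
    simp [mul_comm]
  exact ⟨hrank.trans hedge.symm, hrank, hedge, by lia⟩

end Rigidity
end
end

section
/- Let G′ be a graph with distinct vertices c, a₁, b₁, u, v such that the neighborhood of c in G′ is exactly {a₁, b₁, u, v}. Let p be a framework of G′ such that p(a₁), p(u), p(b₁), p(v) are the four vertices of a non-degenerate square in ℝ³ with p(a₁) and p(v) at opposite corners (hence p(b₁) and p(u) at opposite corners), and p(c) lies on the line through the center of the square perpendicular to its plane, with p(c) not in that plane. Then every equilibrium self-stress s of (G′, p) satisfies s({c,a₁}) = s({c,v}), s({c,b₁}) = s({c,u}), and s({c,a₁}) = −s({c,b₁}). -/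
noncomputable section

open scoped RealInnerProductSpace

namespace Rigidity

variable {V : Type*}

/-- At a vertex with neighbors `a, b, u, v`, the equilibrium condition of a self-stress reads
as a sum of four terms. -/
lemma IsSelfStress.sum_four_neighbors {V : Type*} [Fintype V] [DecidableEq V]
    {G : SimpleGraph V} [DecidableRel G.Adj] {p : V → EuclideanSpace ℝ (Fin 3)}
    {s : Sym2 V → ℝ} (hs : IsSelfStress G p s) {c a b u v : V}
    (hdist : ([a, b, u, v] : List V).Pairwise (· ≠ ·))
    (hnbr : G.neighborSet c = {a, b, u, v}) :
    s s(c, a) • (p c - p a) + (s s(c, b) • (p c - p b) +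
      (s s(c, u) • (p c - p u) + s s(c, v) • (p c - p v))) = 0 := by
  have hfilter : Finset.univ.filter (fun y => G.Adj c y) = {a, b, u, v} := by
    ext y
    have h : y ∈ G.neighborSet c ↔ y ∈ ({a, b, u, v} : Set V) := by rw [hnbr]
    simpa using h
  have h := hs c
  simp only [List.pairwise_cons, List.mem_cons, List.not_mem_nil, or_false, forall_eq_or_imp,
    forall_eq] at hdist
  obtain ⟨⟨hab, hau, hav⟩, ⟨hbu, hbv⟩, huv, -⟩ := hdist
  rw [← Finset.sum_filter, hfilter, Finset.sum_insert (by simp [hab, hau, hav]),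
    Finset.sum_insert (by simp [hbu, hbv]), Finset.sum_insert (by simp [huv]),
    Finset.sum_singleton] at h
  exact h

/-- The coefficients of a linear relation between the vectors from the apex of a pyramid to the
corners `A, -U, U, -A` of its base, where `A`, `U` and the apex `C` are nonzero and pairwise
orthogonal. -/
lemma coeff_eq_of_orthogonal {E : Type*} [NormedAddCommGroup E] [InnerProductSpace ℝ E]
    {A U C : E} (hA : A ≠ 0) (hU : U ≠ 0) (hC : C ≠ 0)
    (hAU : ⟪A, U⟫ = 0) (hCA : ⟪C, A⟫ = 0) (hCU : ⟪C, U⟫ = 0) {α β γ δ : ℝ}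
    (h : α • (C - A) + (β • (C + U) + (γ • (C - U) + δ • (C + A))) = 0) :
    α = δ ∧ β = γ ∧ α = -β := by
  have hUA : ⟪U, A⟫ = 0 := by rw [real_inner_comm, hAU]
  have hAC : ⟪A, C⟫ = 0 := by rw [real_inner_comm, hCA]
  have hUC : ⟪U, C⟫ = 0 := by rw [real_inner_comm, hCU]
  have h₁ := congrArg (fun w => ⟪w, A⟫) h
  have h₂ := congrArg (fun w => ⟪w, U⟫) h
  have h₃ := congrArg (fun w => ⟪w, C⟫) h
  simp only [inner_add_left, inner_sub_left, real_inner_smul_left, inner_zero_left, hAU, hUA,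
    hAC, hCA, hUC, hCU] at h₁ h₂ h₃
  have e₁ : α = δ := mul_right_cancel₀ (inner_self_ne_zero (𝕜 := ℝ).mpr hA) (by linarith)
  have e₂ : β = γ := mul_right_cancel₀ (inner_self_ne_zero (𝕜 := ℝ).mpr hU) (by linarith)
  have e₃ : α + β + γ + δ = 0 :=
    (mul_eq_zero.mp (by linarith : (α + β + γ + δ) * ⟪C, C⟫ = 0)).resolve_right
      (inner_self_ne_zero.mpr hC)
  exact ⟨e₁, e₂, by linarith⟩

/-- Let `c, a₁, b₁, u, v` be distinct vertices with the neighborhood of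
`c` exactly `{a₁, b₁, u, v}`, let `p` place `a₁, u, b₁, v` at the vertices of a
non-degenerate square (with `a₁, v` and `b₁, u` at opposite corners, center `z`) and `c`
on the line through `z` perpendicular to the plane of the square, `p c ≠ z`. Then every
equilibrium self-stress `s` satisfies `s{c,a₁} = s{c,v}`, `s{c,b₁} = s{c,u}` and
`s{c,a₁} = -s{c,b₁}`. -/
theorem stress_around_cone_vertex {V : Type*} [Fintype V] [DecidableEq V]
    (G' : SimpleGraph V) [DecidableRel G'.Adj] (c a₁ b₁ u v : V)
    (hdist : ([c, a₁, b₁, u, v] : List V).Pairwise (· ≠ ·))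
    (hnbr : G'.neighborSet c = {a₁, b₁, u, v})
    (p : V → EuclideanSpace ℝ (Fin 3)) (z : EuclideanSpace ℝ (Fin 3))
    (hz₁ : z = midpoint ℝ (p a₁) (p v)) (hz₂ : z = midpoint ℝ (p u) (p b₁))
    (hlen : ‖p a₁ - z‖ = ‖p u - z‖)
    (hperp : ⟪p a₁ - z, p u - z⟫ = 0)
    (hnondeg : p a₁ ≠ z)
    (hc₁ : ⟪p c - z, p a₁ - z⟫ = 0) (hc₂ : ⟪p c - z, p u - z⟫ = 0)
    (hcz : p c ≠ z)
    (s : Sym2 V → ℝ) (hs : IsSelfStress G' p s) :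
    s s(c, a₁) = s s(c, v) ∧ s s(c, b₁) = s s(c, u) ∧ s s(c, a₁) = - s s(c, b₁) := by
  have h := hs.sum_four_neighbors (List.pairwise_cons.mp hdist).2 hnbr
  have hv : p c - p v = (p c - z) + (p a₁ - z) := by
    have h2 : p a₁ + p v = z + z := by rw [hz₁, midpoint_add_self]
    linear_combination (norm := module) -h2
  have hb : p c - p b₁ = (p c - z) + (p u - z) := by
    have h2 : p u + p b₁ = z + z := by rw [hz₂, midpoint_add_self]
    linear_combination (norm := module) -h2
  have hU : p u - z ≠ 0 := by
    rw [← norm_ne_zero_iff, ← hlen, norm_ne_zero_iff]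
    exact sub_ne_zero.mpr hnondeg
  rw [hv, hb, ← sub_sub_sub_cancel_right (p c) (p a₁) z,
    ← sub_sub_sub_cancel_right (p c) (p u) z] at h
  exact coeff_eq_of_orthogonal (sub_ne_zero.mpr hnondeg) hU (sub_ne_zero.mpr hcz)
    hperp hc₁ hc₂ h

end Rigidity
end
end

section
/- Let G′ be obtained from a base graph G by a double-butterfly split-and-glue at a nonedge {a,b} of G, and let p be a hinged double-butterfly framework of G′. Then every equilibrium self-stress s of (G′, p) satisfies s({a₁,c})(p(a₁)−p(c)) + s({a₁,u})(p(a₁)−p(u)) + s({a₁,v})(p(a₁)−p(v)) + s({a₂,c′})(p(a₂)−p(c′)) + s({a₂,u})(p(a₂)−p(u)) + s({a₂,v})(p(a₂)−p(v)) = 0 in ℝ³. -/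
noncomputable section

open scoped RealInnerProductSpace

namespace Rigidity

variable {V : Type*}

/-- A vertex that is isolated in `G` and is not one of the new vertices stays isolated in a
nonedge-split of `G`. -/
theorem IsNonedgeSplit.not_adj {G Gs : SimpleGraph V} {a b a₁ a₂ b₁ b₂ x : V}
    (h : IsNonedgeSplit G Gs a b a₁ a₂ b₁ b₂) (hx : x ∉ G.support)
    (h₁ : x ≠ a₁) (h₂ : x ≠ a₂) (h₃ : x ≠ b₁) (h₄ : x ≠ b₂) (y : V) : ¬ Gs.Adj x y := by
  obtain ⟨-, -, -, -, -, -, A, hA, B, hB, rfl⟩ := h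
  have hiso : ∀ w, ¬ G.Adj w x := fun w hw => hx ((G.mem_support).2 ⟨w, hw.symm⟩)
  have key : ∀ q r : V, x ≠ q → ∀ W ⊆ G.neighborSet r,
      s(x, y) ∉ (fun w => s(q, w)) '' W := by
    rintro q r hq W hW ⟨w, hw, he⟩
    rcases Sym2.eq_iff.1 he with ⟨e, -⟩ | ⟨-, e⟩
    · exact hq e.symm
    · exact hiso r (e ▸ hW hw)
  rw [SimpleGraph.sup_adj, SimpleGraph.deleteEdges_adj, SimpleGraph.fromEdgeSet_adj]
  rintro (⟨hadj, -⟩ | ⟨((hm | hm) | hm) | hm, -⟩)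
  · exact hiso y hadj.symm
  · exact key a₁ a h₁ A hA hm
  · exact key a₂ a h₂ _ Set.sdiff_subset hm
  · exact key b₁ b h₃ B hB hm
  · exact key b₂ b h₄ _ Set.sdiff_subset hm

/-- The equilibrium condition at a vertex, as a sum over an explicit finset of neighbors. -/
theorem IsSelfStress.sum_eq_zero [Fintype V] {G : SimpleGraph V} [DecidableRel G.Adj]
    {p : V → EuclideanSpace ℝ (Fin 3)} {s : Sym2 V → ℝ} (hs : IsSelfStress G p s) {x : V}
    {F : Finset V} (hF : ∀ y, G.Adj x y ↔ y ∈ F) :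
    ∑ y ∈ F, s s(x, y) • (p x - p y) = 0 := by
  rw [← hs x, ← Finset.sum_filter]
  congr 1
  ext y
  simp [hF]

section StressAlgebra

variable {E : Type*} [NormedAddCommGroup E] [InnerProductSpace ℝ E]

/-- An equilibrium stress at the apex `C` of a pyramid over the square `X, Y, -X, -Y` centered at
the origin has equal coefficients on opposite base vertices, and opposite ones on adjacent
base vertices. -/
theorem pyramid_apex_stress {X Y C : E} (hX : X ≠ 0) (hY : Y ≠ 0) (hC : C ≠ 0)
    (hXY : ⟪X, Y⟫ = 0) (hCX : ⟪C, X⟫ = 0) (hCY : ⟪C, Y⟫ = 0) {k l m n : ℝ}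
    (h : k • (C - X) + l • (C + Y) + m • (C - Y) + n • (C + X) = 0) :
    n = k ∧ l = -k ∧ m = -k := by
  have hX' := (inner_self_ne_zero (𝕜 := ℝ)).2 hX
  have hY' := (inner_self_ne_zero (𝕜 := ℝ)).2 hY
  have hC' := (inner_self_ne_zero (𝕜 := ℝ)).2 hC
  have hYX : ⟪Y, X⟫ = 0 := by rw [real_inner_comm, hXY]
  have eX := congrArg (fun w => ⟪w, X⟫) h
  have eY := congrArg (fun w => ⟪w, Y⟫) h
  have eC := congrArg (fun w => ⟪w, C⟫) h
  have hXC : ⟪X, C⟫ = 0 := by rw [real_inner_comm, hCX]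
  have hYC : ⟪Y, C⟫ = 0 := by rw [real_inner_comm, hCY]
  simp only [inner_add_left, inner_sub_left, real_inner_smul_left, inner_zero_left,
    hXY, hYX, hCX, hCY, hXC, hYC] at eX eY eC
  have e₁ : n - k = 0 := (mul_eq_zero.1 (by linear_combination eX)).resolve_right hX'
  have e₂ : l - m = 0 := (mul_eq_zero.1 (by linear_combination eY)).resolve_right hY'
  have e₃ : k + l + m + n = 0 := (mul_eq_zero.1 (by linear_combination eC)).resolve_right hC'
  exact ⟨by linarith, by linarith, by linarith⟩

/-- Equilibrium at a vertex `Y` of the square `X, Y, -X, -Y`, where `W` is the component of the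
load orthogonal to the plane of the square. -/
theorem square_vertex_stress {X Y W : E} (hX : X ≠ 0) (hY : Y ≠ 0)
    (hXY : ⟪X, Y⟫ = 0) (hWX : ⟪W, X⟫ = 0) (hWY : ⟪W, Y⟫ = 0) {k l t : ℝ}
    (h : k • (Y - X) + l • (Y + Y) - (t • Y - W) = 0) :
    k = 0 ∧ 2 * l = t ∧ W = 0 := by
  have hX' := (inner_self_ne_zero (𝕜 := ℝ)).2 hX
  have hY' := (inner_self_ne_zero (𝕜 := ℝ)).2 hY
  have hYX : ⟪Y, X⟫ = 0 := by rw [real_inner_comm, hXY]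
  have eX := congrArg (fun w => ⟪w, X⟫) h
  have eY := congrArg (fun w => ⟪w, Y⟫) h
  simp only [inner_add_left, inner_sub_left, real_inner_smul_left, inner_zero_left,
    hXY, hYX, hWX, hWY] at eX eY
  have e₁ : k = 0 := (mul_eq_zero.1 (by linear_combination -eX)).resolve_right hX'
  have e₂ : k + 2 * l - t = 0 := (mul_eq_zero.1 (by linear_combination eY)).resolve_right hY'
  obtain rfl : t = 2 * l := by linarith
  refine ⟨e₁, rfl, ?_⟩
  rw [← h, e₁]
  module

end StressAlgebra

/-- Let `G'` be obtained from a base graph `G` by a double-butterfly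
split-and-glue at a nonedge `{a, b}`, and let `p` be a hinged double-butterfly framework
of `G'`. Then every equilibrium self-stress `s` of `(G', p)` satisfies
`s{a₁,c}(p a₁ - p c) + s{a₁,u}(p a₁ - p u) + s{a₁,v}(p a₁ - p v) +
 s{a₂,c'}(p a₂ - p c') + s{a₂,u}(p a₂ - p u) + s{a₂,v}(p a₂ - p v) = 0`. -/
theorem stress_around_a1_a2 {V : Type*} [Fintype V] [DecidableEq V]
    (G G' : SimpleGraph V) [DecidableRel G'.Adj]
    (a b a₁ a₂ b₁ b₂ u v c c' : V)
    (hsg : IsDoubleButterflySG G G' a b a₁ a₂ b₁ b₂ u v c c')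
    (p : V → EuclideanSpace ℝ (Fin 3)) (z : EuclideanSpace ℝ (Fin 3))
    (hpa : p a₁ = p a₂) (hpb : p b₁ = p b₂)
    (hz₁ : z = midpoint ℝ (p a₁) (p v)) (hz₂ : z = midpoint ℝ (p u) (p b₁))
    (hlen : ‖p a₁ - z‖ = ‖p u - z‖)
    (hperp : ⟪p a₁ - z, p u - z⟫ = 0)
    (hnondeg : p a₁ ≠ z)
    (hc₁ : ⟪p c - z, p a₁ - z⟫ = 0) (hc₂ : ⟪p c - z, p u - z⟫ = 0)
    (hc'₁ : ⟪p c' - z, p a₁ - z⟫ = 0) (hc'₂ : ⟪p c' - z, p u - z⟫ = 0)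
    (hcc' : p c ≠ p c') (hcz : p c ≠ z) (hc'z : p c' ≠ z)
    (s : Sym2 V → ℝ) (hs : IsSelfStress G' p s) :
    s s(a₁, c) • (p a₁ - p c) + s s(a₁, u) • (p a₁ - p u) + s s(a₁, v) • (p a₁ - p v) +
      s s(a₂, c') • (p a₂ - p c') + s s(a₂, u) • (p a₂ - p u) +
        s s(a₂, v) • (p a₂ - p v) = 0 := by
  obtain ⟨Gs, hsplit, hne, hu, hv, hc, hc', rfl⟩ := hsg
  simp only [List.pairwise_cons, List.mem_cons, List.not_mem_nil, or_false, forall_eq_or_imp,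
    forall_eq] at hne
  obtain ⟨-, -, ⟨ha12, hab1, hab2, hau, hav, hac, hac'⟩, ⟨ha2b1, ha2b2, ha2u, ha2v, ha2c, ha2c'⟩,
    ⟨hb12, hb1u, hb1v, hb1c, hb1c'⟩, ⟨hb2u, hb2v, hb2c, hb2c'⟩, ⟨huv, huc, huc'⟩, ⟨hvc, hvc'⟩,
    hcc, -⟩ := hne
  have Fu : ∀ y, (Gs ⊔ doubleButterfly a₁ a₂ b₁ b₂ u v c c').Adj u y ↔
      y ∈ ({a₁, a₂, b₁, b₂, c, c'} : Finset V) := fun y => by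
    have := hsplit.not_adj hu hau.symm ha2u.symm hb1u.symm hb2u.symm y
    simp only [SimpleGraph.sup_adj, this, false_or, doubleButterfly,
      SimpleGraph.fromEdgeSet_adj, Set.mem_insert_iff, Set.mem_singleton_iff, Sym2.eq_iff,
      Finset.mem_insert, Finset.mem_singleton]
    grind
  have Fv : ∀ y, (Gs ⊔ doubleButterfly a₁ a₂ b₁ b₂ u v c c').Adj v y ↔
      y ∈ ({a₁, a₂, b₁, b₂, c, c'} : Finset V) := fun y => by
    have := hsplit.not_adj hv hav.symm ha2v.symm hb1v.symm hb2v.symm y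
    simp only [SimpleGraph.sup_adj, this, false_or, doubleButterfly,
      SimpleGraph.fromEdgeSet_adj, Set.mem_insert_iff, Set.mem_singleton_iff, Sym2.eq_iff,
      Finset.mem_insert, Finset.mem_singleton]
    grind
  have Fc : ∀ y, (Gs ⊔ doubleButterfly a₁ a₂ b₁ b₂ u v c c').Adj c y ↔
      y ∈ ({a₁, b₁, u, v} : Finset V) := fun y => by
    have := hsplit.not_adj hc hac.symm ha2c.symm hb1c.symm hb2c.symm y
    simp only [SimpleGraph.sup_adj, this, false_or, doubleButterfly,
      SimpleGraph.fromEdgeSet_adj, Set.mem_insert_iff, Set.mem_singleton_iff, Sym2.eq_iff,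
      Finset.mem_insert, Finset.mem_singleton]
    grind
  have Fc' : ∀ y, (Gs ⊔ doubleButterfly a₁ a₂ b₁ b₂ u v c c').Adj c' y ↔
      y ∈ ({a₂, b₂, u, v} : Finset V) := fun y => by
    have := hsplit.not_adj hc' hac'.symm ha2c'.symm hb1c'.symm hb2c'.symm y
    simp only [SimpleGraph.sup_adj, this, false_or, doubleButterfly,
      SimpleGraph.fromEdgeSet_adj, Set.mem_insert_iff, Set.mem_singleton_iff, Sym2.eq_iff,
      Finset.mem_insert, Finset.mem_singleton]
    grind
  have Eu := hs.sum_eq_zero Fu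
  have Ev := hs.sum_eq_zero Fv
  have Ec := hs.sum_eq_zero Fc
  have Ec' := hs.sum_eq_zero Fc'
  rw [Finset.sum_insert (by simp [*]), Finset.sum_insert (by simp [*]),
    Finset.sum_insert (by simp [*]), Finset.sum_insert (by simp [*]),
    Finset.sum_insert (by simp [*]), Finset.sum_singleton] at Eu Ev
  rw [Finset.sum_insert (by simp [*]), Finset.sum_insert (by simp [*]),
    Finset.sum_insert (by simp [*]), Finset.sum_singleton] at Ec Ec'
  obtain ⟨X, hX⟩ : ∃ X, X = p a₁ - z := ⟨_, rfl⟩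
  obtain ⟨Y, hY⟩ : ∃ Y, Y = p u - z := ⟨_, rfl⟩
  obtain ⟨C, hC⟩ : ∃ C, C = p c - z := ⟨_, rfl⟩
  obtain ⟨C', hC'⟩ : ∃ C', C' = p c' - z := ⟨_, rfl⟩
  have pa₁ : p a₁ = z + X := by rw [hX]; abel
  have pa₂ : p a₂ = z + X := by rw [← hpa, pa₁]
  have pu : p u = z + Y := by rw [hY]; abel
  have pc : p c = z + C := by rw [hC]; abel
  have pc' : p c' = z + C' := by rw [hC']; abel
  have pv : p v = z - X := by
    rw [hX, sub_sub_eq_add_sub, eq_sub_iff_add_eq', ← midpoint_add_self ℝ (p a₁) (p v), ← hz₁]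
  have pb₁ : p b₁ = z - Y := by
    rw [hY, sub_sub_eq_add_sub, eq_sub_iff_add_eq', ← midpoint_add_self ℝ (p u) (p b₁), ← hz₂]
  have pb₂ : p b₂ = z - Y := by rw [← hpb, pb₁]
  rw [← hX, ← hY] at hlen hperp
  rw [← hC, ← hX] at hc₁
  rw [← hC, ← hY] at hc₂
  rw [← hC', ← hX] at hc'₁
  rw [← hC', ← hY] at hc'₂
  have X0 : X ≠ 0 := by rw [hX]; exact sub_ne_zero.2 hnondeg
  have Y0 : Y ≠ 0 := by rw [← norm_ne_zero_iff, ← hlen]; exact norm_ne_zero_iff.2 X0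
  have C0 : C ≠ 0 := by rw [hC]; exact sub_ne_zero.2 hcz
  have C'0 : C' ≠ 0 := by rw [hC']; exact sub_ne_zero.2 hc'z
  rw [pa₁, pb₁, pu, pv, pc] at Ec
  rw [pa₂, pb₂, pu, pv, pc'] at Ec'
  obtain ⟨hcv, hcb, hcu⟩ := pyramid_apex_stress X0 Y0 C0 hperp hc₁ hc₂
    (k := s s(c, a₁)) (l := s s(c, b₁)) (m := s s(c, u)) (n := s s(c, v))
    (by rw [← Ec]; module)
  obtain ⟨hc'v, hc'b, hc'u⟩ := pyramid_apex_stress X0 Y0 C'0 hperp hc'₁ hc'₂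
    (k := s s(c', a₂)) (l := s s(c', b₂)) (m := s s(c', u)) (n := s s(c', v))
    (by rw [← Ec']; module)
  rw [pa₁, pa₂, pb₁, pb₂, pu, pc, pc', Sym2.eq_swap (a := u) (b := a₁),
    Sym2.eq_swap (a := u) (b := a₂), Sym2.eq_swap (a := u) (b := c),
    Sym2.eq_swap (a := u) (b := c'), hcu, hc'u] at Eu
  rw [pa₁, pa₂, pb₁, pb₂, pv, pc, pc', Sym2.eq_swap (a := v) (b := a₁),
    Sym2.eq_swap (a := v) (b := a₂), Sym2.eq_swap (a := v) (b := c),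
    Sym2.eq_swap (a := v) (b := c'), hcv, hc'v] at Ev
  set t := s s(c, a₁)
  set t' := s s(c', a₂)
  have WX : ⟪t • C + t' • C', X⟫ = 0 := by
    simp [inner_add_left, real_inner_smul_left, hc₁, hc'₁]
  have WY : ⟪t • C + t' • C', Y⟫ = 0 := by
    simp [inner_add_left, real_inner_smul_left, hc₂, hc'₂]
  obtain ⟨hα, -, hW⟩ := square_vertex_stress X0 Y0 hperp WX WY
    (k := s s(a₁, u) + s s(a₂, u)) (l := s s(u, b₁) + s s(u, b₂)) (t := t + t')
    (by rw [← Eu]; module)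
  obtain ⟨-, hγ, -⟩ := square_vertex_stress (X := Y) (Y := X) (W := -(t • C + t' • C')) Y0 X0
    (by rw [real_inner_comm, hperp]) (by rw [inner_neg_left, WY, neg_zero])
    (by rw [inner_neg_left, WX, neg_zero])
    (k := -(s s(v, b₁) + s s(v, b₂))) (l := -(s s(a₁, v) + s s(a₂, v))) (t := t + t')
    (by rw [← Ev]; module)
  rw [pa₁, pa₂, pc, pc', pu, pv, Sym2.eq_swap (a := a₁) (b := c),
    Sym2.eq_swap (a := a₂) (b := c')]
  change t • _ + _ + _ + t' • _ + _ + _ = _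
  calc _ = (t + t' + 2 * (s s(a₁, v) + s s(a₂, v))) • X - (t • C + t' • C') +
        (s s(a₁, u) + s s(a₂, u)) • (X - Y) := by module
    _ = 0 := by
      rw [hW, hα, ← hγ]
      module

end Rigidity
end
end
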